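/- Non-uniform Łojasiewicz inequality (greedy-action-set form): for any deterministic optimal policy f* and any parameter θ, ‖∇_θ J(f_θ)‖ ≥ (1/√(|𝒳||𝒜|)) · ‖ν_μ^{f*}/ν_μ^{f_θ}‖_∞^{−1} · [ min_x Σ_{ā(x)∈Ā^{f_θ}(x)} f_θ(x, ā(x)) ] · ( J(f*) − J(f_θ) ), where Ā^f(x) = { ā ∈ 𝒜 : V^f(x,ā) = max_a V^f(x,a) } is the greedy action set of policy f at state x and ‖ν_μ^{f*}/ν_μ^{f_θ}‖_∞ = max_x ν_μ^{f*}(x)/ν_μ^{f_θ}(x). -/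

import Mathlib

open MeasureTheory Filter Set
open scoped Classical

noncomputable section

def softmaxPol {X A : Type*} [Fintype A] (θ : X → A → ℝ) (x : X) (a : A) : ℝ :=
  Real.exp (θ x a) / ∑ a', Real.exp (θ x a')

def explorePol {X A : Type*} [Fintype A] (η : ℝ) (θ : X → A → ℝ) (x : X) (a : A) : ℝ :=
  η / (Fintype.card A : ℝ) + (1 - η) * softmaxPol θ x a

def zetaN (N k : ℕ) : ℝ := (1 + (k : ℝ) / (N : ℝ))⁻¹

def etaN (N k : ℕ) : ℝ := (1 + (Real.log ((k : ℝ) / (N : ℝ) + 1)) ^ 2)⁻¹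

def zetaT (t : ℝ) : ℝ := (1 + t)⁻¹

def etaT (t : ℝ) : ℝ := (1 + (Real.log (t + 1)) ^ 2)⁻¹

def IsPolicy {X A : Type*} [Fintype A] (f : X → A → ℝ) : Prop :=
  (∀ x a, 0 ≤ f x a) ∧ ∀ x, ∑ a, f x a = 1

def ptilde {X A : Type*} (γ : ℝ) (p : X → A → X → ℝ) (μ : X → ℝ)
    (x : X) (a : A) (x' : X) : ℝ :=
  γ * p x a x' + (1 - γ) * μ x'

def actorKer {X A : Type*} (γ : ℝ) (p : X → A → X → ℝ) (μ : X → ℝ) (f : X → A → ℝ) :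
    X × A → X × A → ℝ :=
  fun ξ ξ' => ptilde γ p μ ξ.1 ξ.2 ξ'.1 * f ξ'.1 ξ'.2

def criticKer {X A : Type*} (p : X → A → X → ℝ) (g : X → A → ℝ) :
    X × A → X × A → ℝ :=
  fun ξ ξ' => p ξ.1 ξ.2 ξ'.1 * g ξ'.1 ξ'.2

def kpow {S : Type*} [Fintype S] [DecidableEq S] (K : S → S → ℝ) : ℕ → S → S → ℝ
  | 0 => fun ξ ξ' => if ξ = ξ' then 1 else 0
  | n + 1 => fun ξ ξ' => ∑ y, K ξ y * kpow K n y ξ'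

def IsStationaryDist {S : Type*} [Fintype S] (K : S → S → ℝ) (d : S → ℝ) : Prop :=
  (∀ ξ, 0 ≤ d ξ) ∧ (∑ ξ, d ξ = 1) ∧ ∀ ξ', d ξ' = ∑ ξ, d ξ * K ξ ξ'

def pathSum {X A : Type*} [Fintype X] [Fintype A] [DecidableEq X]
    (p : X → A → X → ℝ) : ℕ → X → A → X → ℝ
  | 0 => fun x _ x' => if x = x' then 1 else 0
  | 1 => fun x a x' => p x a x'
  | n + 2 => fun x a x' => ∑ x₁ : X, ∑ a₁ : A, p x a x₁ * pathSum p (n + 1) x₁ a₁ x'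

section Helpers

theorem isPolicy_softmaxPol {X A : Type*} [Fintype A] [Nonempty A] (θ : X → A → ℝ) :
    IsPolicy (softmaxPol θ) := by
  refine ⟨fun x a => by unfold softmaxPol; positivity, fun x => ?_⟩
  have hZ : (0 : ℝ) < ∑ a', Real.exp (θ x a') :=
    Finset.sum_pos (fun a _ => Real.exp_pos _) Finset.univ_nonempty
  simp only [softmaxPol, ← Finset.sum_div]
  exact div_self hZ.ne'

theorem softmaxPol_pos {X A : Type*} [Fintype A] [Nonempty A] (θ : X → A → ℝ) (x : X)
    (a : A) : 0 < softmaxPol θ x a :=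
  div_pos (Real.exp_pos _) (Finset.sum_pos (fun _ _ => Real.exp_pos _) Finset.univ_nonempty)

variable {X A : Type*} [Fintype X] [Fintype A]

theorem sum_flow {p : X → A → X → ℝ} (hp1 : ∀ x a, ∑ x', p x a x' = 1) (g : X → A → ℝ) :
    ∑ x, ∑ x', ∑ a', g x' a' * p x' a' x = ∑ x', ∑ a', g x' a' := by
  rw [Finset.sum_comm]
  refine Finset.sum_congr rfl fun x' _ => ?_
  rw [Finset.sum_comm]
  refine Finset.sum_congr rfl fun a' _ => ?_
  rw [← Finset.mul_sum, hp1, mul_one]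

/-- Total mass bound for subsolutions of the discounted flow equation. -/
theorem sum_le_of_le_flow {p : X → A → X → ℝ} {γ : ℝ} (hp1 : ∀ x a, ∑ x', p x a x' = 1)
    {f : X → A → ℝ} (hf : IsPolicy f) {n b : X → ℝ}
    (h : ∀ x, n x ≤ b x + γ * ∑ x', ∑ a', n x' * f x' a' * p x' a' x) :
    (1 - γ) * ∑ x, n x ≤ ∑ x, b x := by
  have h1 := Finset.sum_le_sum fun x (_ : x ∈ Finset.univ) => h x
  rw [Finset.sum_add_distrib, ← Finset.mul_sum, sum_flow hp1 fun x a => n x * f x a] at h1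
  simp only [← Finset.mul_sum, hf.2, mul_one] at h1
  linarith

theorem eq_zero_of_le_flow {p : X → A → X → ℝ} {γ : ℝ} (hγ : γ < 1)
    (hp1 : ∀ x a, ∑ x', p x a x' = 1) {f : X → A → ℝ} (hf : IsPolicy f) {n : X → ℝ}
    (hn : ∀ x, 0 ≤ n x) (h : ∀ x, n x ≤ γ * ∑ x', ∑ a', n x' * f x' a' * p x' a' x) (x : X) :
    n x = 0 := by
  have h1 := sum_le_of_le_flow (b := fun _ => 0) hp1 hf (by simpa using h)
  simp only [Finset.sum_const_zero] at h1
  have h2 : ∑ x, n x ≤ 0 := by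
    by_contra! h3
    have := mul_pos (sub_pos.2 hγ) h3
    linarith
  exact le_antisymm ((Finset.single_le_sum (fun y _ => hn y) (Finset.mem_univ x)).trans h2) (hn x)

section Flow

variable {p : X → A → X → ℝ} {μ : X → ℝ} {γ : ℝ} {f g : X → A → ℝ} {n m : X → ℝ}

theorem flow_nonneg (hp0 : ∀ x a x', 0 ≤ p x a x') (hp1 : ∀ x a, ∑ x', p x a x' = 1)
    (hμ0 : ∀ x, 0 ≤ μ x) (hγ0 : 0 ≤ γ) (hγ1 : γ < 1) (hf : IsPolicy f)
    (hn : ∀ x, n x = μ x + γ * ∑ x', ∑ a', n x' * f x' a' * p x' a' x) (x : X) : 0 ≤ n x := by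
  have h := eq_zero_of_le_flow hγ1 hp1 hf (n := fun x => max (-n x) 0)
    (fun x => le_max_right _ _) (fun x => ?_) x
  · have := le_max_left (-n x) 0
    linarith
  · have hterm : ∀ x' a', 0 ≤ f x' a' * p x' a' x := fun x' a' =>
      mul_nonneg (hf.1 _ _) (hp0 _ _ _)
    refine max_le ?_ ?_
    · have h1 : -∑ x', ∑ a', n x' * f x' a' * p x' a' x
          ≤ ∑ x', ∑ a', max (-n x') 0 * f x' a' * p x' a' x := by
        simp only [← Finset.sum_neg_distrib]
        refine Finset.sum_le_sum fun x' _ => Finset.sum_le_sum fun a' _ => ?_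
        have := mul_le_mul_of_nonneg_right (le_max_left (-n x') 0) (hterm x' a')
        linarith
      have := mul_le_mul_of_nonneg_left h1 hγ0
      rw [hn x]
      linarith [hμ0 x]
    · refine mul_nonneg hγ0 (Finset.sum_nonneg fun x' _ => Finset.sum_nonneg fun a' _ => ?_)
      rw [mul_assoc]
      exact mul_nonneg (le_max_right _ _) (hterm _ _)

/-- States that are not visited under a fully supported policy `f` are visited under no policy. -/
theorem flow_eq_zero_of_pos (hp0 : ∀ x a x', 0 ≤ p x a x') (hp1 : ∀ x a, ∑ x', p x a x' = 1)
    (hμ0 : ∀ x, 0 ≤ μ x) (hγ0 : 0 < γ) (hγ1 : γ < 1) (hf : IsPolicy f)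
    (hfpos : ∀ x a, 0 < f x a) (hg : IsPolicy g)
    (hn : ∀ x, n x = μ x + γ * ∑ x', ∑ a', n x' * f x' a' * p x' a' x)
    (hm : ∀ x, m x = μ x + γ * ∑ x', ∑ a', m x' * g x' a' * p x' a' x)
    {x : X} (hx : n x = 0) : m x = 0 := by
  have hn0 := flow_nonneg hp0 hp1 hμ0 hγ0.le hγ1 hf hn
  have hm0 := flow_nonneg hp0 hp1 hμ0 hγ0.le hγ1 hg hm
  have h := eq_zero_of_le_flow hγ1 hp1 hg (n := fun x => if n x = 0 then m x else 0)
    (fun x => by split_ifs <;> simp [hm0]) (fun x => ?_) x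
  · simpa [hx] using h
  · have hnonneg : ∀ x' a', 0 ≤ (if n x' = 0 then m x' else 0) * g x' a' * p x' a' x := by
      intro x' a'
      refine mul_nonneg (mul_nonneg ?_ (hg.1 _ _)) (hp0 _ _ _)
      split_ifs <;> simp [hm0]
    by_cases h0 : n x = 0
    · have hS : ∀ x' a', 0 ≤ n x' * f x' a' * p x' a' x := fun x' a' =>
        mul_nonneg (mul_nonneg (hn0 _) (hf.1 _ _)) (hp0 _ _ _)
      have hS' : ∀ x', 0 ≤ ∑ a', n x' * f x' a' * p x' a' x := fun x' =>
        Finset.sum_nonneg fun a' _ => hS x' a'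
      have hsum : 0 ≤ ∑ x', ∑ a', n x' * f x' a' * p x' a' x :=
        Finset.sum_nonneg fun x' _ => hS' x'
      have hxeq := hn x
      rw [h0] at hxeq
      have hμx : μ x = 0 := by nlinarith [hμ0 x, mul_nonneg hγ0.le hsum]
      have hz : ∑ x', ∑ a', n x' * f x' a' * p x' a' x = 0 := by
        rw [hμx, zero_add] at hxeq
        exact (mul_eq_zero.1 hxeq.symm).resolve_left hγ0.ne'
      have hz' : ∀ x' a', n x' * f x' a' * p x' a' x = 0 := fun x' a' =>
        (Finset.sum_eq_zero_iff_of_nonneg fun a' _ => hS x' a').1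
          ((Finset.sum_eq_zero_iff_of_nonneg fun x' _ => hS' x').1 hz x' (Finset.mem_univ _))
          a' (Finset.mem_univ _)
      simp only [h0, if_true]
      rw [hm x, hμx, zero_add]
      refine (congrArg (γ * ·) ?_).le
      refine Finset.sum_congr rfl fun x' _ => Finset.sum_congr rfl fun a' _ => ?_
      by_cases hx' : n x' = 0
      · simp [hx']
      · have : p x' a' x = 0 :=
          (mul_eq_zero.1 (hz' x' a')).resolve_left (mul_ne_zero hx' (hfpos _ _).ne')
        simp [this]
    · simp only [h0, if_false]
      exact mul_nonneg hγ0.le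
        (Finset.sum_nonneg fun x' _ => Finset.sum_nonneg fun a' _ => hnonneg x' a')

theorem flow_sub_le (hp0 : ∀ x a x', 0 ≤ p x a x') (hp1 : ∀ x a, ∑ x', p x a x' = 1)
    (hγ0 : 0 ≤ γ) (hγ1 : γ < 1) (hg : IsPolicy g)
    (hn : ∀ x, n x = μ x + γ * ∑ x', ∑ a', n x' * f x' a' * p x' a' x)
    (hm : ∀ x, m x = μ x + γ * ∑ x', ∑ a', m x' * g x' a' * p x' a' x) (x : X) :
    |m x - n x| ≤ γ * (∑ x', ∑ a', |n x'| * |g x' a' - f x' a'|) / (1 - γ) := by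
  have h := sum_le_of_le_flow (γ := γ) hp1 hg (n := fun x => |m x - n x|)
    (b := fun x => γ * ∑ x', ∑ a', |n x'| * |g x' a' - f x' a'| * p x' a' x) (fun x => ?_)
  · rw [← Finset.mul_sum, sum_flow hp1 fun x a => |n x| * |g x a - f x a|] at h
    rw [le_div_iff₀ (sub_pos.2 hγ1), mul_comm]
    refine le_trans (mul_le_mul_of_nonneg_left ?_ (sub_pos.2 hγ1).le) h
    exact Finset.single_le_sum (f := fun x => |m x - n x|) (fun y _ => abs_nonneg _)
      (Finset.mem_univ x)
  · have h1 : m x - n x = γ * ∑ x', ∑ a', (n x' * (g x' a' - f x' a') * p x' a' x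
        + (m x' - n x') * g x' a' * p x' a' x) := by
      rw [hm x, hn x, add_sub_add_left_eq_sub, ← mul_sub]
      simp only [← Finset.sum_sub_distrib]
      congr 1
      refine Finset.sum_congr rfl fun x' _ => Finset.sum_congr rfl fun a' _ => ?_
      ring
    rw [h1, abs_mul, abs_of_nonneg hγ0, ← mul_add]
    refine mul_le_mul_of_nonneg_left ?_ hγ0
    simp only [← Finset.sum_add_distrib]
    refine (Finset.abs_sum_le_sum_abs _ _).trans (Finset.sum_le_sum fun x' _ => ?_)
    refine (Finset.abs_sum_le_sum_abs _ _).trans (Finset.sum_le_sum fun a' _ => ?_)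
    refine (abs_add_le _ _).trans (le_of_eq ?_)
    simp only [abs_mul, abs_of_nonneg (hp0 x' a' x), abs_of_nonneg (hg.1 x' a')]

theorem sum_init_mul_eq (hn : ∀ x, n x = μ x + γ * ∑ x', ∑ a', n x' * f x' a' * p x' a' x)
    (W : X → ℝ) :
    ∑ x, μ x * W x = ∑ x, n x * (W x - γ * ∑ a, f x a * ∑ x', p x a x' * W x') := by
  have hμ : ∀ x, μ x = n x - γ * ∑ x', ∑ a', n x' * f x' a' * p x' a' x := fun x => by
    linarith [hn x]
  have hswap : ∑ x, (∑ x', ∑ a', n x' * f x' a' * p x' a' x) * W x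
      = ∑ x, n x * ∑ a, f x a * ∑ x', p x a x' * W x' := by
    simp only [Finset.sum_mul, Finset.mul_sum]
    rw [Finset.sum_comm]
    refine Finset.sum_congr rfl fun x _ => ?_
    rw [Finset.sum_comm]
    refine Finset.sum_congr rfl fun a _ => Finset.sum_congr rfl fun x' _ => ?_
    ring
  calc ∑ x, μ x * W x
      = ∑ x, n x * W x - γ * ∑ x, (∑ x', ∑ a', n x' * f x' a' * p x' a' x) * W x := by
        rw [Finset.mul_sum, ← Finset.sum_sub_distrib]
        refine Finset.sum_congr rfl fun x _ => ?_
        rw [hμ x]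
        ring
    _ = _ := by
        rw [hswap, Finset.mul_sum, ← Finset.sum_sub_distrib]
        refine Finset.sum_congr rfl fun x _ => ?_
        ring

/-- Performance difference lemma. -/
theorem performance_difference {r Q Q' : X → A → ℝ} (hg : IsPolicy g)
    (hQ : ∀ x a, Q x a = r x a + γ * ∑ x', p x a x' * ∑ a', f x' a' * Q x' a')
    (hQ' : ∀ x a, Q' x a = r x a + γ * ∑ x', p x a x' * ∑ a', g x' a' * Q' x' a')
    (hm : ∀ x, m x = μ x + γ * ∑ x', ∑ a', m x' * g x' a' * p x' a' x) :
    ∑ x, μ x * ∑ a, g x a * Q' x a - ∑ x, μ x * ∑ a, f x a * Q x a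
      = ∑ x, m x * ∑ a, g x a * (Q x a - ∑ a', f x a' * Q x a') := by
  rw [← Finset.sum_sub_distrib]
  simp only [← mul_sub]
  rw [sum_init_mul_eq hm fun x => ∑ a, g x a * Q' x a - ∑ a, f x a * Q x a]
  refine Finset.sum_congr rfl fun x _ => congrArg (m x * ·) ?_
  have h1 : ∀ a, γ * ∑ x', p x a x' * (∑ a, g x' a * Q' x' a - ∑ a, f x' a * Q x' a)
      = Q' x a - Q x a := fun a => by
    simp only [mul_sub, Finset.sum_sub_distrib]
    linarith [hQ x a, hQ' x a]
  rw [Finset.mul_sum]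
  simp only [mul_left_comm γ, h1]
  simp only [mul_sub, Finset.sum_sub_distrib, ← Finset.sum_mul, hg.2]
  ring

end Flow

theorem hasDerivAt_mul_of_eq_zero {g h : ℝ → ℝ} {u h' : ℝ} (hg : ContinuousAt g u)
    (hh : HasDerivAt h h' u) (h0 : h u = 0) :
    HasDerivAt (fun v => g v * h v) (g u * h') u := by
  rw [hasDerivAt_iff_tendsto_slope] at hh ⊢
  refine ((hg.tendsto.mono_left nhdsWithin_le_nhds).mul hh).congr fun v => ?_
  simp only [slope_def_field, h0]
  ring

theorem sum_abs_le_sqrt_card_mul (G : X → A → ℝ) :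
    ∑ x, ∑ a, |G x a| ≤ Real.sqrt ((Fintype.card X : ℝ) * (Fintype.card A : ℝ))
      * Real.sqrt (∑ x, ∑ a, G x a ^ 2) := by
  rw [← Real.sqrt_mul (by positivity)]
  refine Real.le_sqrt_of_sq_le ?_
  have h := sq_sum_le_card_mul_sum_sq (s := (Finset.univ : Finset (X × A)))
    (f := fun z => |G z.1 z.2|)
  simpa only [Fintype.sum_prod_type, sq_abs, Finset.card_univ, Fintype.card_prod,
    Nat.cast_mul] using h

/-- Policy gradient theorem for the tabular softmax parametrization, coordinatewise. -/
theorem hasDerivAt_softmax_objective [Nonempty A] [DecidableEq X] [DecidableEq A]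
    {p : X → A → X → ℝ} {μ : X → ℝ} {r : X → A → ℝ} {γ : ℝ}
    (hp0 : ∀ x a x', 0 ≤ p x a x') (hp1 : ∀ x a, ∑ x', p x a x' = 1)
    (hγ0 : 0 ≤ γ) (hγ1 : γ < 1) {Vq : (X → A → ℝ) → X → A → ℝ}
    (hVq : ∀ f : X → A → ℝ, IsPolicy f → ∀ x a,
      Vq f x a = r x a + γ * ∑ x', p x a x' * ∑ a', f x' a' * Vq f x' a')
    {J : (X → A → ℝ) → ℝ}
    (hJ : ∀ f : X → A → ℝ, IsPolicy f → J f = ∑ x, μ x * ∑ a, f x a * Vq f x a)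
    {nu : (X → A → ℝ) → X → ℝ}
    (hnu : ∀ f : X → A → ℝ, IsPolicy f → ∀ x,
      nu f x = μ x + γ * ∑ x', ∑ a', nu f x' * f x' a' * p x' a' x)
    (θ : X → A → ℝ) (x : X) (a : A) :
    HasDerivAt
      (fun u : ℝ => J (softmaxPol (fun x' a' => if x' = x ∧ a' = a then u else θ x' a')))
      (nu (softmaxPol θ) x * softmaxPol θ x a *
        (Vq (softmaxPol θ) x a - ∑ a', softmaxPol θ x a' * Vq (softmaxPol θ) x a')) (θ x a) := by
  set f := softmaxPol θ with hf
  set T : ℝ → X → A → ℝ := fun u x' a' => if x' = x ∧ a' = a then u else θ x' a' with hT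
  set Ad : X → A → ℝ := fun y b => Vq f y b - ∑ a', f y a' * Vq f y a' with hAd
  have hfp : IsPolicy f := isPolicy_softmaxPol θ
  have hTp : ∀ u, IsPolicy (softmaxPol (T u)) := fun u => isPolicy_softmaxPol _
  have hTθ : T (θ x a) = θ := by
    funext x' a'
    simp only [hT]
    split_ifs with h
    · rw [h.1, h.2]
    · rfl
  have hTcont : ∀ y b, Continuous fun u => T u y b := fun y b => by
    by_cases h : y = x ∧ b = a
    · simpa [hT, h] using continuous_id'
    · simpa [hT, h] using continuous_const
  have hZpos : ∀ (τ : X → A → ℝ) y, 0 < ∑ b, Real.exp (τ y b) := fun τ y =>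
    Finset.sum_pos (fun _ _ => Real.exp_pos _) Finset.univ_nonempty
  have hZcont : ∀ y, Continuous fun u => ∑ b, Real.exp (T u y b) := fun y =>
    continuous_finsetSum _ fun b _ => Real.continuous_exp.comp (hTcont y b)
  have hScont : ∀ y b, Continuous fun u => softmaxPol (T u) y b := fun y b =>
    (Real.continuous_exp.comp (hTcont y b)).div (hZcont y) fun u => (hZpos _ y).ne'
  have hnucont : ContinuousAt (fun u => nu (softmaxPol (T u)) x) (θ x a) := by
    have hbound : Tendsto (fun u => γ * (∑ x', ∑ a', |nu f x'| *
        |softmaxPol (T u) x' a' - f x' a'|) / (1 - γ)) (nhds (θ x a)) (nhds 0) := by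
      have hc : Continuous (fun u => γ * (∑ x', ∑ a', |nu f x'| *
          |softmaxPol (T u) x' a' - f x' a'|) / (1 - γ)) := by
        refine Continuous.div_const (continuous_const.mul ?_) _
        refine continuous_finsetSum _ fun x' _ => continuous_finsetSum _ fun a' _ => ?_
        exact continuous_const.mul ((hScont x' a').sub continuous_const).abs
      have := hc.tendsto (θ x a)
      simpa [hTθ, ← hf] using this
    rw [ContinuousAt, hTθ, tendsto_iff_dist_tendsto_zero]
    refine squeeze_zero (fun _ => dist_nonneg) (fun u => ?_) hbound
    rw [Real.dist_eq]
    exact flow_sub_le hp0 hp1 hγ0 hγ1 (hTp u) (hnu f hfp) (hnu _ (hTp u)) x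
  have hAd0 : ∀ y, ∑ b, Real.exp (θ y b) * Ad y b = 0 := fun y => by
    have h1 : ∑ b, f y b * Ad y b = 0 := by
      simp only [hAd, mul_sub, Finset.sum_sub_distrib, ← Finset.sum_mul, hfp.2, one_mul, sub_self]
    have h2 : ∀ b, Real.exp (θ y b) = (∑ b', Real.exp (θ y b')) * f y b := fun b => by
      rw [hf, softmaxPol, mul_div_cancel₀ _ (hZpos θ y).ne']
    calc ∑ b, Real.exp (θ y b) * Ad y b
        = (∑ b', Real.exp (θ y b')) * ∑ b, f y b * Ad y b := by
          rw [Finset.mul_sum]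
          exact Finset.sum_congr rfl fun b _ => by rw [h2 b, mul_assoc]
      _ = 0 := by rw [h1, mul_zero]
  have hnum : ∀ u y, ∑ b, Real.exp (T u y b) * Ad y b
      = if y = x then (Real.exp u - Real.exp (θ x a)) * Ad x a else 0 := fun u y => by
    have hsub : ∑ b, Real.exp (T u y b) * Ad y b
        = ∑ b, (Real.exp (T u y b) * Ad y b - Real.exp (θ y b) * Ad y b) := by
      rw [Finset.sum_sub_distrib, hAd0, sub_zero]
    rw [hsub]
    by_cases hy : y = x
    · subst hy
      rw [Finset.sum_eq_single a]
      · simp [hT, sub_mul]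
      · intro b _ hb
        simp [hT, hb]
      · simp
    · rw [if_neg hy]
      exact Finset.sum_eq_zero fun b _ => by simp [hT, hy]
  have hsum : ∀ u y, ∑ b, softmaxPol (T u) y b * Ad y b
      = (if y = x then (Real.exp u - Real.exp (θ x a)) * Ad x a else 0)
        / ∑ b, Real.exp (T u y b) := fun u y => by
    rw [← hnum, Finset.sum_div]
    exact Finset.sum_congr rfl fun b _ => by rw [softmaxPol, div_mul_eq_mul_div]
  have hJu : ∀ u, J (softmaxPol (T u)) = (nu (softmaxPol (T u)) x * Ad x a
      / ∑ b, Real.exp (T u x b)) * (Real.exp u - Real.exp (θ x a)) + J f := fun u => by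
    rw [← sub_eq_iff_eq_add, hJ _ (hTp u), hJ f hfp,
      performance_difference (hTp u) (hVq f hfp) (hVq _ (hTp u)) (hnu _ (hTp u))]
    rw [Finset.sum_eq_single x]
    · rw [hsum, if_pos rfl]
      ring
    · intro y _ hy
      rw [hsum, if_neg hy, zero_div, mul_zero]
    · simp
  have hder := hasDerivAt_mul_of_eq_zero
    ((hnucont.mul_const (Ad x a)).div (hZcont x).continuousAt (hZpos _ x).ne')
    ((Real.hasDerivAt_exp (θ x a)).sub_const (Real.exp (θ x a))) (sub_self _)
  refine ((hder.add_const (J f)).congr_deriv ?_).congr_of_eventuallyEq (Eventually.of_forall hJu)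
  simp only [Pi.div_apply, hTθ, hAd, hf, softmaxPol]
  ring

end Helpers

theorem lojasiewicz_greedy_set
    {X A : Type*} [Fintype X] [Fintype A] [Nonempty X] [Nonempty A]
    [DecidableEq X] [DecidableEq A]
    (p : X → A → X → ℝ) (μ : X → ℝ) (r : X → A → ℝ) (γ α : ℝ)
    (hp0 : ∀ x a x', 0 ≤ p x a x') (hp1 : ∀ x a, ∑ x', p x a x' = 1)
    (hμ0 : ∀ x, 0 ≤ μ x) (hμ1 : ∑ x, μ x = 1)
    (hr : ∀ x a, 0 ≤ r x a ∧ r x a ≤ 1) (hγ : 0 < γ ∧ γ < 1) (hα : 0 < α)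
    (Vq : (X → A → ℝ) → X → A → ℝ)
    (hVq : ∀ f : X → A → ℝ, IsPolicy f → ∀ x a,
      Vq f x a = r x a + γ * ∑ x', p x a x' * ∑ a', f x' a' * Vq f x' a')
    (J : (X → A → ℝ) → ℝ)
    (hJ : ∀ f : X → A → ℝ, IsPolicy f → J f = ∑ x, μ x * ∑ a, f x a * Vq f x a)
    (nu : (X → A → ℝ) → X → ℝ)
    (hnu : ∀ f : X → A → ℝ, IsPolicy f → ∀ x,
      nu f x = μ x + γ * ∑ x', ∑ a', nu f x' * f x' a' * p x' a' x)
    (fstar : X → A → ℝ) (hfstarPol : IsPolicy fstar)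
    (hfstarOpt : ∀ f : X → A → ℝ, IsPolicy f → J f ≤ J fstar)
    (astar : X → A) (hdet : ∀ x a, fstar x a = if a = astar x then 1 else 0)
    (θ : X → A → ℝ) (grad : X → A → ℝ)
    (hgrad : ∀ x a, HasDerivAt
      (fun u : ℝ => J (softmaxPol (fun x' a' => if x' = x ∧ a' = a then u else θ x' a')))
      (grad x a) (θ x a)) :
    (Real.sqrt ((Fintype.card X : ℝ) * (Fintype.card A : ℝ)))⁻¹ *
      (Finset.univ.sup' Finset.univ_nonempty
        (fun x => nu fstar x / nu (softmaxPol θ) x))⁻¹ *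
      (Finset.univ.inf' Finset.univ_nonempty (fun x =>
        ∑ a ∈ Finset.univ.filter (fun a => Vq (softmaxPol θ) x a =
            Finset.univ.sup' Finset.univ_nonempty (fun a' => Vq (softmaxPol θ) x a')),
          softmaxPol θ x a)) *
      (J fstar - J (softmaxPol θ))
    ≤ Real.sqrt (∑ x, ∑ a, grad x a ^ 2) := by
  obtain ⟨hγ0, hγ1⟩ := hγ
  set f := softmaxPol θ with hf
  have hfp : IsPolicy f := isPolicy_softmaxPol θ
  have hfpos : ∀ x a, 0 < f x a := softmaxPol_pos θ
  have hn0 := flow_nonneg hp0 hp1 hμ0 hγ0.le hγ1 hfp (hnu f hfp)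
  have hs0 := flow_nonneg hp0 hp1 hμ0 hγ0.le hγ1 hfstarPol (hnu fstar hfstarPol)
  have hgradeq : ∀ x a, grad x a =
      nu f x * f x a * (Vq f x a - ∑ a', f x a' * Vq f x a') := fun x a =>
    (hgrad x a).unique (hasDerivAt_softmax_objective hp0 hp1 hγ0.le hγ1 hVq hJ hnu θ x a)
  set C := Finset.univ.sup' Finset.univ_nonempty (fun x => nu fstar x / nu f x) with hC
  set G : X → Finset A := fun x => Finset.univ.filter (fun a => Vq f x a =
    Finset.univ.sup' Finset.univ_nonempty (fun a' => Vq f x a')) with hG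
  set c := Finset.univ.inf' Finset.univ_nonempty (fun x => ∑ a ∈ G x, f x a) with hc
  set M : X → ℝ := fun x => Finset.univ.sup' Finset.univ_nonempty (fun a' => Vq f x a')
    - ∑ a', f x a' * Vq f x a' with hM
  have hQle : ∀ x a, Vq f x a ≤ Finset.univ.sup' Finset.univ_nonempty (fun a' => Vq f x a') :=
    fun x a => Finset.le_sup' (fun a' => Vq f x a') (Finset.mem_univ a)
  have hM0 : ∀ x, 0 ≤ M x := fun x => by
    have h := Finset.sum_le_sum fun a (_ : a ∈ Finset.univ) =>
      mul_le_mul_of_nonneg_left (hQle x a) (hfp.1 x a)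
    rw [← Finset.sum_mul, hfp.2, one_mul] at h
    exact sub_nonneg.2 h
  have hc0 : 0 ≤ c := Finset.le_inf' _ _ fun x _ => Finset.sum_nonneg fun a _ => hfp.1 x a
  have hdiv : ∀ x, nu fstar x / nu f x ≤ C := fun x =>
    Finset.le_sup' (fun x => nu fstar x / nu f x) (Finset.mem_univ x)
  have hC0 : 0 ≤ C := by
    obtain ⟨x⟩ := ‹Nonempty X›
    exact (div_nonneg (hs0 x) (hn0 x)).trans (hdiv x)
  have hratio : ∀ x, nu fstar x ≤ C * nu f x := fun x => by
    rcases (hn0 x).eq_or_lt with h | h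
    · rw [flow_eq_zero_of_pos hp0 hp1 hμ0 hγ0 hγ1 hfp hfpos hfstarPol (hnu f hfp)
        (hnu fstar hfstarPol) h.symm, ← h, mul_zero]
    · exact (div_le_iff₀ h).1 (hdiv x)
  have hgap : J fstar - J f ≤ C * ∑ x, nu f x * M x := by
    rw [hJ _ hfstarPol, hJ f hfp, performance_difference hfstarPol (hVq f hfp)
      (hVq _ hfstarPol) (hnu _ hfstarPol), Finset.mul_sum]
    refine Finset.sum_le_sum fun x _ => ?_
    have h1 : ∑ a, fstar x a * (Vq f x a - ∑ a', f x a' * Vq f x a') ≤ M x := by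
      have h := Finset.sum_le_sum fun a (_ : a ∈ Finset.univ) =>
        mul_le_mul_of_nonneg_left (sub_le_sub_right (hQle x a) (∑ a', f x a' * Vq f x a'))
          (hfstarPol.1 x a)
      rwa [← Finset.sum_mul, hfstarPol.2, one_mul] at h
    calc _ ≤ nu fstar x * M x := mul_le_mul_of_nonneg_left h1 (hs0 x)
      _ ≤ C * nu f x * M x := mul_le_mul_of_nonneg_right (hratio x) (hM0 x)
      _ = _ := mul_assoc _ _ _
  have hl1 : c * ∑ x, nu f x * M x ≤ ∑ x, ∑ a, |grad x a| := by
    rw [Finset.mul_sum]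
    refine Finset.sum_le_sum fun x _ => ?_
    calc c * (nu f x * M x) ≤ (∑ a ∈ G x, f x a) * (nu f x * M x) :=
          mul_le_mul_of_nonneg_right
            (Finset.inf'_le (fun x => ∑ a ∈ G x, f x a) (Finset.mem_univ x))
            (mul_nonneg (hn0 x) (hM0 x))
      _ = ∑ a ∈ G x, grad x a := by
          rw [Finset.sum_mul]
          refine Finset.sum_congr rfl fun a ha => ?_
          rw [hgradeq, (Finset.mem_filter.1 ha).2]
          simp only [hM]
          ring
      _ ≤ ∑ a ∈ G x, |grad x a| := Finset.sum_le_sum fun a _ => le_abs_self _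
      _ ≤ ∑ a, |grad x a| := Finset.sum_le_sum_of_subset_of_nonneg (Finset.subset_univ _)
          fun a _ _ => abs_nonneg _
  have hscaled : C⁻¹ * c * (J fstar - J f) ≤ ∑ x, ∑ a, |grad x a| := by
    rcases hC0.eq_or_lt with h | h
    · rw [← h, inv_zero, zero_mul, zero_mul]
      positivity
    · calc C⁻¹ * c * (J fstar - J f) ≤ C⁻¹ * c * (C * ∑ x, nu f x * M x) :=
            mul_le_mul_of_nonneg_left hgap (by positivity)
        _ = c * ∑ x, nu f x * M x := by
            field_simp
        _ ≤ _ := hl1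
  have hcard : 0 < Real.sqrt ((Fintype.card X : ℝ) * (Fintype.card A : ℝ)) := by
    have := Fintype.card_pos (α := X)
    have := Fintype.card_pos (α := A)
    positivity
  rw [mul_assoc, mul_assoc, inv_mul_le_iff₀ hcard, ← mul_assoc]
  exact hscaled.trans (sum_abs_le_sqrt_card_mul grad)
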